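/- Let n ≥ 6 be an integer divisible by 6, and consider the action of G on the set ℬ_n of triple points. Then ℬ_n has exactly one G-orbit of cardinality 1, namely the singleton {(0,0)} (in particular the origin is a triple point), exactly n/2 − 2 orbits of cardinality 3, and exactly (n−6)²/36 orbits of cardinality 6. -/

import Mathlib

open Complex

/-- `P n j = exp(2πij/n)`. -/
noncomputable def Ppt (n j : ℕ) : ℂ := Complex.exp (2 * Real.pi * Complex.I * j / n)

/-- `Q n j = -exp(-4πij/n)`. -/
noncomputable def Qpt (n j : ℕ) : ℂ := -Complex.exp (-(4 * Real.pi * Complex.I * j) / n)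

open scoped Classical in
/-- The `j`-th line of the Böröczky configuration: the line through `P n j` and
`Q n j` if they are distinct, and the tangent line to the unit circle at `P n j`
otherwise (identifying ℝ² with ℂ). -/
noncomputable def Bline (n j : ℕ) : Set ℂ :=
  if Ppt n j = Qpt n j then
    {z : ℂ | (z * (starRingEnd ℂ) (Ppt n j)).re = 1}
  else
    {z : ℂ | ((z - Ppt n j) * (starRingEnd ℂ) (Qpt n j - Ppt n j)).im = 0}

/-- The set of triple points of the Böröczky configuration: points lying on at
least three of the lines `L_0, …, L_{n-1}`. -/
def TriplePts (n : ℕ) : Set ℂ :=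
  {z : ℂ | 3 ≤ ({j : ℕ | j < n ∧ z ∈ Bline n j} : Set ℕ).ncard}

noncomputable def rotPerm : Equiv.Perm ℂ :=
  Equiv.mulLeft₀ (Complex.exp (2 * Real.pi * Complex.I / 3)) (Complex.exp_ne_zero _)

noncomputable def conjPerm : Equiv.Perm ℂ :=
  ⟨fun z => (starRingEnd ℂ) z, fun z => (starRingEnd ℂ) z,
    fun z => by simp, fun z => by simp⟩

noncomputable def dihedralG : Subgroup (Equiv.Perm ℂ) :=
  Subgroup.closure {rotPerm, conjPerm}

def Gorbit (v : ℂ) : Set ℂ := {z : ℂ | ∃ g ∈ dihedralG, g v = z}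

open Finset in
/-- A map all of whose fibres have `k` elements is `k`-to-one onto its image. -/
lemma card_eq_card_image_mul {α β : Type*} [DecidableEq β] (s : Finset α) (f : α → β) (k : ℕ)
    (h : ∀ a ∈ s, #{x ∈ s | f x = f a} = k) : #s = #(s.image f) * k := by
  rw [Finset.card_eq_sum_card_image f s]
  refine Finset.sum_const_nat fun b hb => ?_
  obtain ⟨a, ha, rfl⟩ := Finset.mem_image.mp hb
  exact h a ha

lemma conj_eq_inv_of_pow_eq_one {a : ℂ} {n : ℕ} (hn : n ≠ 0) (h : a ^ n = 1) :
    (starRingEnd ℂ) a = a⁻¹ :=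
  (Complex.inv_eq_conj (Complex.norm_eq_one_of_pow_eq_one h hn)).symm

lemma ne_zero_of_pow_eq_one {a : ℂ} {n : ℕ} (hn : n ≠ 0) (h : a ^ n = 1) : a ≠ 0 := by
  rintro rfl
  simp [hn] at h

section Lines

lemma Ppt_eq_pow (n j : ℕ) : Ppt n j = Complex.exp (2 * Real.pi * Complex.I / n) ^ j := by
  rw [Ppt, ← Complex.exp_nat_mul]
  congr 1
  ring

lemma Ppt_pow {n : ℕ} (hn : n ≠ 0) (j : ℕ) : Ppt n j ^ n = 1 := by
  rw [Ppt_eq_pow, ← pow_mul, Nat.mul_comm, pow_mul,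
    (Complex.isPrimitiveRoot_exp n hn).pow_eq_one, one_pow]

lemma Qpt_eq (n j : ℕ) : Qpt n j = -((Ppt n j)⁻¹) ^ 2 := by
  rw [Qpt, Ppt, ← Complex.exp_neg, ← Complex.exp_nat_mul]
  congr 2
  push_cast
  ring

lemma Ppt_injOn {n : ℕ} (hn : n ≠ 0) {i j : ℕ} (hi : i < n) (hj : j < n)
    (h : Ppt n i = Ppt n j) : i = j := by
  rw [Ppt_eq_pow, Ppt_eq_pow] at h
  exact (Complex.isPrimitiveRoot_exp n hn).pow_inj hi hj h

/-- A point `z` lies on the line `L_j` iff `P_j` is a root of `t³ - z t² + z̄ t - 1`. -/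
lemma mem_Bline_iff {n : ℕ} (hn : n ≠ 0) (j : ℕ) (z : ℂ) :
    z ∈ Bline n j ↔
      Ppt n j ^ 3 - z * Ppt n j ^ 2 + (starRingEnd ℂ) z * Ppt n j - 1 = 0 := by
  have hw := Ppt_pow hn j
  have hq := Qpt_eq n j
  have hc := conj_eq_inv_of_pow_eq_one hn hw
  have h0 := ne_zero_of_pow_eq_one hn hw
  unfold Bline
  set w := Ppt n j
  set u := w⁻¹ with hu
  have huc : (starRingEnd ℂ) u = w := by rw [← hc, Complex.conj_conj]
  have hwu : w * u = 1 := mul_inv_cancel₀ h0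
  split_ifs with h
  · have h3 : w ^ 3 = -1 := by
      have : w = -u ^ 2 := h.trans hq
      linear_combination w ^ 2 * this - (w * u + 1) * hwu
    have h2 : w ^ 2 = -u := by linear_combination u * h3 - w ^ 2 * hwu
    rw [Set.mem_ofPred_eq, hc]
    have hre : ((2 * (z * u).re : ℝ) : ℂ) = z * u + (starRingEnd ℂ) z * w := by
      rw [← Complex.add_conj, map_mul, huc]
    constructor
    · intro h1
      rw [h1] at hre
      push_cast at hre
      linear_combination h3 - z * h2 - hre
    · intro h1
      have : ((2 * (z * u).re : ℝ) : ℂ) = (2 : ℝ) := by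
        rw [hre]; push_cast; linear_combination h1 - h3 + z * h2
      have := Complex.ofReal_injective this
      linarith
  · have hne : 1 + u ^ 3 ≠ 0 := by
      intro h3
      apply h
      rw [hq]
      linear_combination w * h3 - u ^ 2 * hwu
    rw [Set.mem_ofPred_eq, ← Complex.conj_eq_iff_im, hq]
    simp only [map_mul, map_sub, map_neg, map_pow, huc, hc]
    set y := (starRingEnd ℂ) z
    have key : (w ^ 3 - z * w ^ 2 + y * w - 1) * (1 + u ^ 3)
        = (z - w) * (-w ^ 2 - u) - (y - u) * (-u ^ 2 - w) := by
      linear_combination ((w * u) ^ 2 + w * u + 1 - z * u * (w * u + 1) + y * u ^ 2) * hwu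
    rw [eq_comm, ← sub_eq_zero, ← key, mul_eq_zero, or_iff_left hne]

end Lines

section TripleSums

variable {n : ℕ}

lemma mem_roots_iff (hn : n ≠ 0) {a : ℂ} :
    a ∈ Polynomial.nthRootsFinset n (1 : ℂ) ↔ a ^ n = 1 :=
  Polynomial.mem_nthRootsFinset (Nat.pos_of_ne_zero hn) 1

lemma cubic_eq_prod (hn : n ≠ 0) {a b c : ℂ} (ha : a ^ n = 1) (hb : b ^ n = 1) (hc : c ^ n = 1)
    (habc : a * b * c = 1) (t : ℂ) :
    t ^ 3 - (a + b + c) * t ^ 2 + (starRingEnd ℂ) (a + b + c) * t - 1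
      = (t - a) * (t - b) * (t - c) := by
  have ha0 := ne_zero_of_pow_eq_one hn ha
  have hb0 := ne_zero_of_pow_eq_one hn hb
  have hc0 := ne_zero_of_pow_eq_one hn hc
  rw [map_add, map_add, conj_eq_inv_of_pow_eq_one hn ha, conj_eq_inv_of_pow_eq_one hn hb,
    conj_eq_inv_of_pow_eq_one hn hc]
  have h1 : a⁻¹ = b * c := inv_eq_of_mul_eq_one_right (by linear_combination habc)
  have h2 : b⁻¹ = a * c := inv_eq_of_mul_eq_one_right (by linear_combination habc)
  have h3 : c⁻¹ = a * b := inv_eq_of_mul_eq_one_right (by linear_combination habc)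
  rw [h1, h2, h3]
  linear_combination habc

/-- If two triples of roots of unity with product `1` have the same sum, they agree as sets. -/
lemma mem_of_sum_eq (hn : n ≠ 0) {a b c x y w : ℂ}
    (ha : a ^ n = 1) (hb : b ^ n = 1) (hc : c ^ n = 1) (habc : a * b * c = 1)
    (hx : x ^ n = 1) (hy : y ^ n = 1) (hw : w ^ n = 1) (hxyw : x * y * w = 1)
    (h : x + y + w = a + b + c) : x = a ∨ x = b ∨ x = c := by
  have h1 := cubic_eq_prod hn ha hb hc habc x
  rw [← h, cubic_eq_prod hn hx hy hw hxyw x, sub_self, zero_mul, zero_mul, eq_comm, mul_eq_zero,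
    mul_eq_zero, sub_eq_zero, sub_eq_zero, sub_eq_zero] at h1
  tauto

/-- Triple points are the sums of three distinct `n`-th roots of unity with product `1`. -/
lemma mem_TriplePts_iff (hn : n ≠ 0) (z : ℂ) :
    z ∈ TriplePts n ↔ ∃ a b c : ℂ, a ^ n = 1 ∧ b ^ n = 1 ∧ c ^ n = 1 ∧ a ≠ b ∧ a ≠ c ∧ b ≠ c ∧
      a * b * c = 1 ∧ z = a + b + c := by
  have hfin : ({j : ℕ | j < n ∧ z ∈ Bline n j} : Set ℕ).Finite :=
    (Set.finite_lt_nat n).subset fun j hj => hj.1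
  have hsurj : ∀ a : ℂ, a ^ n = 1 → ∃ j < n, Ppt n j = a := by
    intro a ha
    have : NeZero n := ⟨hn⟩
    obtain ⟨i, hi, h⟩ := (Complex.isPrimitiveRoot_exp n hn).eq_pow_of_pow_eq_one ha
    exact ⟨i, hi, by rw [Ppt_eq_pow, h]⟩
  rw [TriplePts, Set.mem_ofPred_eq, ← Nat.lt_iff_add_one_le (m := 2), Set.two_lt_ncard hfin]
  constructor
  · rintro ⟨i, ⟨hi, hzi⟩, j, ⟨hj, hzj⟩, k, ⟨hk, hzk⟩, hij, hik, hjk⟩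
    rw [mem_Bline_iff hn] at hzi hzj hzk
    have hij' : Ppt n i ≠ Ppt n j := fun h => hij (Ppt_injOn hn hi hj h)
    have hik' : Ppt n i ≠ Ppt n k := fun h => hik (Ppt_injOn hn hi hk h)
    have hjk' : Ppt n j ≠ Ppt n k := fun h => hjk (Ppt_injOn hn hj hk h)
    refine ⟨_, _, _, Ppt_pow hn i, Ppt_pow hn j, Ppt_pow hn k, hij', hik', hjk', ?_⟩
    generalize Ppt n i = a at *
    generalize Ppt n j = b at *
    generalize Ppt n k = c at *
    have h1 : a ^ 2 + a * b + b ^ 2 - z * (a + b) + (starRingEnd ℂ) z = 0 := by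
      apply mul_left_cancel₀ (sub_ne_zero.mpr hij')
      linear_combination hzi - hzj
    have h2 : a ^ 2 + a * c + c ^ 2 - z * (a + c) + (starRingEnd ℂ) z = 0 := by
      apply mul_left_cancel₀ (sub_ne_zero.mpr hik')
      linear_combination hzi - hzk
    have h3 : z = a + b + c := by
      apply mul_left_cancel₀ (sub_ne_zero.mpr hjk')
      linear_combination h2 - h1
    refine ⟨?_, h3⟩
    rw [h3] at h1 hzi
    linear_combination hzi - a * h1
  · rintro ⟨a, b, c, ha, hb, hc, hab, hac, hbc, habc, rfl⟩
    obtain ⟨i, hi, hi'⟩ := hsurj a ha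
    obtain ⟨j, hj, hj'⟩ := hsurj b hb
    obtain ⟨k, hk, hk'⟩ := hsurj c hc
    refine ⟨i, ⟨hi, ?_⟩, j, ⟨hj, ?_⟩, k, ⟨hk, ?_⟩, ?_, ?_, ?_⟩
    · rw [mem_Bline_iff hn, cubic_eq_prod hn ha hb hc habc, hi']; ring
    · rw [mem_Bline_iff hn, cubic_eq_prod hn ha hb hc habc, hj']; ring
    · rw [mem_Bline_iff hn, cubic_eq_prod hn ha hb hc habc, hk']; ring
    · rintro rfl; exact hab (hi'.symm.trans hj')
    · rintro rfl; exact hac (hi'.symm.trans hk')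
    · rintro rfl; exact hbc (hj'.symm.trans hk')

lemma card_roots (hn : n ≠ 0) : (Polynomial.nthRootsFinset n (1 : ℂ)).card = n :=
  (Complex.isPrimitiveRoot_exp n hn).card_nthRootsFinset

open Classical in
/-- Pairs `(a, b)` of `n`-th roots of unity such that `a`, `b`, `(ab)⁻¹` are distinct. -/
noncomputable def triplePairs (n : ℕ) : Finset (ℂ × ℂ) :=
  (Polynomial.nthRootsFinset n (1 : ℂ) ×ˢ Polynomial.nthRootsFinset n (1 : ℂ)).filter
    fun p => ¬ (p.1 = p.2 ∨ p.1 ^ 2 * p.2 = 1 ∨ p.1 * p.2 ^ 2 = 1)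

lemma mem_triplePairs (hn : n ≠ 0) (p : ℂ × ℂ) :
    p ∈ triplePairs n ↔ p.1 ^ n = 1 ∧ p.2 ^ n = 1 ∧ p.1 ≠ p.2 ∧ p.1 ^ 2 * p.2 ≠ 1 ∧
      p.1 * p.2 ^ 2 ≠ 1 := by
  simp only [triplePairs, Finset.mem_filter, Finset.mem_product, mem_roots_iff hn]
  tauto

lemma card_triplePairs (hn : n ≠ 0) (h3 : 3 ∣ n) : (triplePairs n).card + 3 * n = n ^ 2 + 6 := by
  classical
  set R := Polynomial.nthRootsFinset n (1 : ℂ) with hR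
  have hcR : R.card = n := card_roots hn
  set R3 := Polynomial.nthRootsFinset 3 (1 : ℂ) with hR3
  have hcR3 : R3.card = 3 := card_roots (by norm_num)
  have hR3R : ∀ a : ℂ, a ^ 3 = 1 → a ^ n = 1 := fun a h => by
    obtain ⟨k, rfl⟩ := h3
    rw [pow_mul, h, one_pow]
  set A := R.image fun a => (a, a) with hA
  set B := R.image fun a => (a, (a ^ 2)⁻¹) with hB
  set C := R.image fun a => ((a ^ 2)⁻¹, a) with hC
  set D := R3.image fun a => (a, a) with hD
  have hcA : A.card = n := by
    rw [hA, Finset.card_image_of_injective _ fun a b h => (Prod.ext_iff.mp h).1, hcR]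
  have hcB : B.card = n := by
    rw [hB, Finset.card_image_of_injective _ fun a b h => (Prod.ext_iff.mp h).1, hcR]
  have hcC : C.card = n := by
    rw [hC, Finset.card_image_of_injective _ fun a b h => (Prod.ext_iff.mp h).2, hcR]
  have hcD : D.card = 3 := by
    rw [hD, Finset.card_image_of_injective _ fun a b h => (Prod.ext_iff.mp h).1, hcR3]
  have hmA : ∀ p : ℂ × ℂ, p ∈ A ↔ p.1 ^ n = 1 ∧ p.2 ^ n = 1 ∧ p.1 = p.2 := by
    rintro ⟨a, b⟩
    simp only [hA, Finset.mem_image, hR, mem_roots_iff hn, Prod.mk.injEq]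
    constructor
    · rintro ⟨x, hx, rfl, rfl⟩; exact ⟨hx, hx, rfl⟩
    · rintro ⟨hx, -, rfl⟩; exact ⟨a, hx, rfl, rfl⟩
  have hmB : ∀ p : ℂ × ℂ, p ∈ B ↔ p.1 ^ n = 1 ∧ p.2 ^ n = 1 ∧ p.1 ^ 2 * p.2 = 1 := by
    rintro ⟨a, b⟩
    simp only [hB, Finset.mem_image, hR, mem_roots_iff hn, Prod.mk.injEq]
    constructor
    · rintro ⟨x, hx, rfl, rfl⟩
      have hx0 := ne_zero_of_pow_eq_one hn hx
      refine ⟨hx, ?_, mul_inv_cancel₀ (pow_ne_zero _ hx0)⟩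
      rw [inv_pow, ← pow_mul, Nat.mul_comm, pow_mul, hx, one_pow, inv_one]
    · rintro ⟨hx, -, h⟩; exact ⟨a, hx, rfl, inv_eq_of_mul_eq_one_right h⟩
  have hmC : ∀ p : ℂ × ℂ, p ∈ C ↔ p.1 ^ n = 1 ∧ p.2 ^ n = 1 ∧ p.1 * p.2 ^ 2 = 1 := by
    rintro ⟨a, b⟩
    simp only [hC, Finset.mem_image, hR, mem_roots_iff hn, Prod.mk.injEq]
    constructor
    · rintro ⟨x, hx, rfl, rfl⟩
      have hx0 := ne_zero_of_pow_eq_one hn hx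
      refine ⟨?_, hx, inv_mul_cancel₀ (pow_ne_zero _ hx0)⟩
      rw [inv_pow, ← pow_mul, Nat.mul_comm, pow_mul, hx, one_pow, inv_one]
    · rintro ⟨-, hx, h⟩; exact ⟨b, hx, inv_eq_of_mul_eq_one_left h, rfl⟩
  have hmD : ∀ p : ℂ × ℂ, p ∈ D ↔ p.1 ^ n = 1 ∧ p.2 ^ n = 1 ∧ p.1 = p.2 ∧ p.1 ^ 3 = 1 := by
    rintro ⟨a, b⟩
    simp only [hD, Finset.mem_image, hR3, mem_roots_iff (n := 3) (by norm_num), Prod.mk.injEq]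
    constructor
    · rintro ⟨x, hx, rfl, rfl⟩; exact ⟨hR3R _ hx, hR3R _ hx, rfl, hx⟩
    · rintro ⟨-, -, rfl, hx⟩; exact ⟨a, hx, rfl, rfl⟩
  have hBC : ∀ p ∈ B, p ∈ C → p ∈ A := by
    intro p hb hc
    rw [hmB] at hb
    rw [hmC] at hc
    rw [hmA]
    refine ⟨hb.1, hb.2.1, ?_⟩
    linear_combination p.2 * hb.2.2 - p.1 * hc.2.2
  have hAB : A ∩ B = D := by
    ext ⟨a, b⟩
    rw [Finset.mem_inter, hmA, hmB, hmD]
    constructor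
    · rintro ⟨⟨ha, hb, h⟩, -, -, h'⟩
      dsimp only at *
      subst h
      exact ⟨ha, hb, rfl, by linear_combination h'⟩
    · rintro ⟨ha, hb, h, h'⟩
      dsimp only at *
      subst h
      exact ⟨⟨ha, hb, rfl⟩, ha, hb, by linear_combination h'⟩
  have hABC : (A ∪ B) ∩ C = D := by
    ext ⟨a, b⟩
    have hbc := hBC (a, b)
    rw [Finset.mem_inter, Finset.mem_union]
    constructor
    · rintro ⟨h1, h2⟩
      have h1 : (a, b) ∈ A := h1.elim id fun h => hbc h h2
      rw [hmA] at h1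
      rw [hmC] at h2
      rw [hmD]
      obtain ⟨ha, hb, h⟩ := h1
      dsimp only at *
      subst h
      exact ⟨ha, hb, rfl, by linear_combination h2.2.2⟩
    · rw [hmA, hmC, hmD]
      rintro ⟨ha, hb, h, h'⟩
      dsimp only at *
      subst h
      exact ⟨Or.inl ⟨ha, hb, rfl⟩, ha, hb, by linear_combination h'⟩
  have e1 := Finset.card_union_add_card_inter A B
  have e2 := Finset.card_union_add_card_inter (A ∪ B) C
  have e3 : ((A ∪ B) ∪ C).card + (triplePairs n).card = n * n := by
    have : (A ∪ B) ∪ C = (R ×ˢ R).filter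
        fun p => p.1 = p.2 ∨ p.1 ^ 2 * p.2 = 1 ∨ p.1 * p.2 ^ 2 = 1 := by
      ext p
      simp only [Finset.mem_union, hmA, hmB, hmC, Finset.mem_filter, Finset.mem_product, hR,
        mem_roots_iff hn]
      tauto
    rw [this, triplePairs, Finset.card_filter_add_card_filter_not, Finset.card_product, hcR]
  rw [hAB, hcA, hcB, hcD] at e1
  rw [hABC, hcC, hcD] at e2
  rw [sq]
  omega

open Classical in
/-- The triple points as a finite set. -/
noncomputable def tripleFinset (n : ℕ) : Finset ℂ :=
  (triplePairs n).image fun p => p.1 + p.2 + (p.1 * p.2)⁻¹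

lemma triple_of_mem_triplePairs (hn : n ≠ 0) {p : ℂ × ℂ} (hp : p ∈ triplePairs n) :
    ∃ c : ℂ, (p.1 * p.2)⁻¹ = c ∧ p.1 ^ n = 1 ∧ p.2 ^ n = 1 ∧ c ^ n = 1 ∧
      p.1 ≠ p.2 ∧ p.1 ≠ c ∧ p.2 ≠ c ∧ p.1 * p.2 * c = 1 := by
  obtain ⟨ha, hb, h1, h2, h3⟩ := (mem_triplePairs hn p).mp hp
  have h0 : p.1 * p.2 ≠ 0 :=
    mul_ne_zero (ne_zero_of_pow_eq_one hn ha) (ne_zero_of_pow_eq_one hn hb)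
  have hm := mul_inv_cancel₀ h0
  refine ⟨_, rfl, ha, hb, by rw [inv_pow, mul_pow, ha, hb, one_mul, inv_one], h1, fun h => h2 ?_,
    fun h => h3 ?_, hm⟩
  · rw [← h] at hm; linear_combination hm
  · rw [← h] at hm; linear_combination hm

lemma mem_triplePairs_of_triple (hn : n ≠ 0) {a b c : ℂ} (ha : a ^ n = 1) (hb : b ^ n = 1)
    (hab : a ≠ b) (hac : a ≠ c) (hbc : b ≠ c) (habc : a * b * c = 1) :
    (a, b) ∈ triplePairs n := by
  have ha0 := ne_zero_of_pow_eq_one hn ha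
  have hb0 := ne_zero_of_pow_eq_one hn hb
  refine (mem_triplePairs hn _).mpr ⟨ha, hb, hab, fun h => hac ?_, fun h => hbc ?_⟩
  · apply mul_left_cancel₀ (mul_ne_zero ha0 hb0)
    linear_combination h - habc
  · apply mul_left_cancel₀ (mul_ne_zero ha0 hb0)
    linear_combination h - habc

lemma mem_tripleFinset (hn : n ≠ 0) (z : ℂ) : z ∈ tripleFinset n ↔ z ∈ TriplePts n := by
  classical
  rw [mem_TriplePts_iff hn, tripleFinset, Finset.mem_image]
  constructor
  · rintro ⟨p, hp, rfl⟩
    obtain ⟨c, hc, h1, h2, h3, h4, h5, h6, h7⟩ := triple_of_mem_triplePairs hn hp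
    exact ⟨p.1, p.2, c, h1, h2, h3, h4, h5, h6, h7, by rw [hc]⟩
  · rintro ⟨a, b, c, ha, hb, hc, hab, hac, hbc, habc, rfl⟩
    refine ⟨(a, b), mem_triplePairs_of_triple hn ha hb hab hac hbc habc, ?_⟩
    dsimp only
    rw [inv_eq_of_mul_eq_one_right habc]

lemma card_tripleFinset (hn : n ≠ 0) (h3 : 3 ∣ n) :
    (tripleFinset n).card * 6 + 3 * n = n ^ 2 + 6 := by
  classical
  rw [← card_triplePairs hn h3, tripleFinset, ← card_eq_card_image_mul]
  rintro ⟨a, b⟩ hp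
  obtain ⟨c, hc, h1, h2, h3, h4, h5, h6, h7⟩ := triple_of_mem_triplePairs hn hp
  dsimp only at *
  have : {x ∈ triplePairs n | x.1 + x.2 + (x.1 * x.2)⁻¹ = a + b + (a * b)⁻¹}
      = {(a, b), (b, a), (a, c), (c, a), (b, c), (c, b)} := by
    ext ⟨x, y⟩
    rw [hc, Finset.mem_filter]
    simp only [Finset.mem_insert, Finset.mem_singleton, Prod.mk.injEq]
    constructor
    · rintro ⟨hxy, hsum⟩
      obtain ⟨w, hw, g1, g2, g3, g4, -, -, g7⟩ := triple_of_mem_triplePairs hn hxy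
      dsimp only at *
      rw [hw] at hsum
      have hx := mem_of_sum_eq hn h1 h2 h3 h7 g1 g2 g3 g7 hsum
      have hy := mem_of_sum_eq hn h1 h2 h3 h7 g2 g1 g3 (by linear_combination g7)
        (by linear_combination hsum)
      rcases hx with rfl | rfl | rfl <;> rcases hy with rfl | rfl | rfl <;> simp_all
    · have key : ∀ x y w : ℂ, x ^ n = 1 → y ^ n = 1 → x ≠ y → x ≠ w → y ≠ w → x * y * w = 1 →
          x + y + w = a + b + c → (x, y) ∈ triplePairs n ∧ x + y + (x * y)⁻¹ = a + b + c := by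
        intro x y w k1 k2 k3 k4 k5 k6 k7
        refine ⟨mem_triplePairs_of_triple hn k1 k2 k3 k4 k5 k6, ?_⟩
        rw [inv_eq_of_mul_eq_one_right k6, k7]
      rintro (⟨rfl, rfl⟩ | ⟨rfl, rfl⟩ | ⟨rfl, rfl⟩ | ⟨rfl, rfl⟩ | ⟨rfl, rfl⟩ | ⟨rfl, rfl⟩)
      · exact key _ _ c h1 h2 h4 h5 h6 h7 rfl
      · exact key _ _ c h2 h1 h4.symm h6 h5 (by linear_combination h7) (by ring)
      · exact key _ _ b h1 h3 h5 h4 h6.symm (by linear_combination h7) (by ring)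
      · exact key _ _ b h3 h1 h5.symm h6.symm h4 (by linear_combination h7) (by ring)
      · exact key _ _ a h2 h3 h6 h4.symm h5.symm (by linear_combination h7) (by ring)
      · exact key _ _ a h3 h2 h6.symm h5.symm h4.symm (by linear_combination h7) (by ring)
  rw [this]
  simp [Finset.card_insert_of_notMem, h4, h5, h6, h4.symm, h5.symm, h6.symm]

lemma zero_mem_tripleFinset (hn : n ≠ 0) (h3 : 3 ∣ n) : (0 : ℂ) ∈ tripleFinset n := by
  rw [mem_tripleFinset hn, mem_TriplePts_iff hn]
  have hζ := Complex.isPrimitiveRoot_exp 3 (by norm_num)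
  set ζ := Complex.exp (2 * Real.pi * Complex.I / (3 : ℕ))
  have hR : ∀ a : ℂ, a ^ 3 = 1 → a ^ n = 1 := fun a h => by
    obtain ⟨k, rfl⟩ := h3
    rw [pow_mul, h, one_pow]
  have h1 : ζ ≠ 1 := hζ.ne_one (by norm_num)
  have hp := hζ.pow_eq_one
  have h0 : ζ ≠ 0 := hζ.ne_zero (by norm_num)
  refine ⟨1, ζ, ζ ^ 2, one_pow _, hR _ hp, hR _ ?_, h1.symm, fun h => ?_, fun h => ?_, ?_, ?_⟩
  · linear_combination (ζ ^ 3 + 1) * hp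
  · exact h1 (by linear_combination hp + ζ * h)
  · exact h1 (mul_left_cancel₀ h0 (by linear_combination -h))
  · linear_combination hp
  · apply mul_left_cancel₀ (sub_ne_zero.mpr h1)
    linear_combination -hp

open Classical in
/-- The real triple points are the `n / 2 - 1` points `1 + b + b⁻¹` with `b ≠ ±1`. -/
lemma card_real_tripleFinset (hn : n ≠ 0) (h2 : 2 ∣ n) :
    ((tripleFinset n).filter fun z => (starRingEnd ℂ) z = z).card * 2 + 2 = n := by
  set R := Polynomial.nthRootsFinset n (1 : ℂ) with hR
  have hmem : ∀ b : ℂ, b ∈ (R.erase 1).erase (-1) ↔ b ^ n = 1 ∧ b ≠ 1 ∧ b ≠ -1 := by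
    intro b
    rw [Finset.mem_erase, Finset.mem_erase, hR, mem_roots_iff hn]
    tauto
  have hcard : ((R.erase 1).erase (-1)).card + 2 = n := by
    have hcR : R.card = n := card_roots hn
    have h1 : (1 : ℂ) ∈ R := by rw [hR, mem_roots_iff hn, one_pow]
    have hm1 : (-1 : ℂ) ∈ R.erase 1 := by
      rw [Finset.mem_erase, hR, mem_roots_iff hn]
      exact ⟨by norm_num, (even_iff_two_dvd.mpr h2).neg_one_pow⟩
    have e1 := Finset.card_erase_add_one h1
    have e2 := Finset.card_erase_add_one hm1
    omega
  have himg : (tripleFinset n).filter (fun z => (starRingEnd ℂ) z = z)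
      = ((R.erase 1).erase (-1)).image fun b => 1 + b + b⁻¹ := by
    ext z
    rw [Finset.mem_filter, mem_tripleFinset hn, mem_TriplePts_iff hn, Finset.mem_image]
    constructor
    · have key : ∀ b c : ℂ, b ^ n = 1 → 1 ≠ b → 1 ≠ c → b ≠ c → b * c = 1 →
          ∃ x ∈ (R.erase 1).erase (-1), 1 + x + x⁻¹ = 1 + b + c := by
        intro b c hb h1 h1' hbc hp
        have hc : b⁻¹ = c := inv_eq_of_mul_eq_one_right hp
        refine ⟨b, (hmem b).mpr ⟨hb, h1.symm, fun h => hbc ?_⟩, by rw [hc]⟩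
        rw [← hc, h]
        norm_num
      rintro ⟨⟨a, b, c, ha, hb, hc, hab, hac, hbc, habc, rfl⟩, hz⟩
      have h1 := cubic_eq_prod hn ha hb hc habc 1
      rw [hz] at h1
      have h1 : (1 - a) * (1 - b) * (1 - c) = 0 := by rw [← h1]; ring
      rw [mul_eq_zero, mul_eq_zero, sub_eq_zero, sub_eq_zero, sub_eq_zero] at h1
      rcases h1 with (rfl | rfl) | rfl
      · exact key b c hb hab hac hbc (by linear_combination habc)
      · rw [add_comm a 1]
        exact key a c ha hab.symm hbc hac (by linear_combination habc)
      · rw [show a + b + 1 = 1 + a + b by ring]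
        exact key a b ha hac.symm hbc.symm hab (by linear_combination habc)
    · rintro ⟨b, hb, rfl⟩
      obtain ⟨hb, h1, h2⟩ := (hmem b).mp hb
      have hb0 := ne_zero_of_pow_eq_one hn hb
      refine ⟨⟨1, b, b⁻¹, one_pow _, hb, by rw [inv_pow, hb, inv_one], h1.symm, ?_, ?_, ?_, rfl⟩,
        ?_⟩
      · intro h; exact h1 (inv_eq_one.mp h.symm)
      · intro h
        have : (b - 1) * (b + 1) = 0 := by
          have := mul_inv_cancel₀ hb0
          rw [← h] at this
          linear_combination this
        rcases mul_eq_zero.mp this with h | h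
        · exact h1 (sub_eq_zero.mp h)
        · exact h2 (eq_neg_of_add_eq_zero_left h)
      · rw [one_mul, mul_inv_cancel₀ hb0]
      · rw [map_add, map_add, map_inv₀, conj_eq_inv_of_pow_eq_one hn hb, map_one, inv_inv]
        ring
  rw [himg, ← card_eq_card_image_mul, hcard]
  intro b hb
  obtain ⟨hb', h1, h2⟩ := (hmem b).mp hb
  have hb0 := ne_zero_of_pow_eq_one hn hb'
  have hne : b ≠ b⁻¹ := by
    intro h
    have : (b - 1) * (b + 1) = 0 := by
      have := mul_inv_cancel₀ hb0
      rw [← h] at this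
      linear_combination this
    rcases mul_eq_zero.mp this with h | h
    · exact h1 (sub_eq_zero.mp h)
    · exact h2 (eq_neg_of_add_eq_zero_left h)
  rw [← Finset.card_pair hne]
  congr 1
  ext x
  rw [Finset.mem_filter, hmem, Finset.mem_insert, Finset.mem_singleton]
  constructor
  · rintro ⟨⟨hx, hx1, hx2⟩, h⟩
    have hx0 := ne_zero_of_pow_eq_one hn hx
    have : (x - b) * (x * b - 1) = 0 := by
      field_simp at h
      linear_combination h
    rcases mul_eq_zero.mp this with h | h
    · exact Or.inl (sub_eq_zero.mp h)
    · exact Or.inr (eq_inv_of_mul_eq_one_left (sub_eq_zero.mp h))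
  · rintro (rfl | rfl)
    · exact ⟨⟨hb', h1, h2⟩, rfl⟩
    · refine ⟨⟨by rw [inv_pow, hb', inv_one], fun h => h1 (inv_eq_one.mp h), fun h => h2 ?_⟩, ?_⟩
      · rw [← inv_inv b, h]; norm_num
      · rw [inv_inv]; ring

end TripleSums

section Orbits

lemma conj_eq_sq_of_cube {u : ℂ} (h : u ^ 3 = 1) : (starRingEnd ℂ) u = u ^ 2 := by
  rw [conj_eq_inv_of_pow_eq_one (by norm_num) h]
  exact inv_eq_of_mul_eq_one_right (by linear_combination h)

lemma exists_of_mem_dihedralG {g : Equiv.Perm ℂ} (hg : g ∈ dihedralG) :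
    ∃ u : ℂ, u ^ 3 = 1 ∧ ((∀ v, g v = u * v) ∨ ∀ v, g v = u * (starRingEnd ℂ) v) := by
  induction hg using Subgroup.closure_induction with
  | mem x hx =>
    rcases hx with rfl | rfl
    · refine ⟨_, ?_, Or.inl fun v => rfl⟩
      simpa using (Complex.isPrimitiveRoot_exp 3 (by norm_num)).pow_eq_one
    · exact ⟨1, one_pow _, Or.inr fun v => (one_mul _).symm⟩
  | one => exact ⟨1, one_pow _, Or.inl fun v => (one_mul _).symm⟩
  | mul x y _ _ hx hy =>
    obtain ⟨u, hu, hx⟩ := hx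
    obtain ⟨w, hw, hy⟩ := hy
    have hw' : ((starRingEnd ℂ) w) ^ 3 = 1 := by rw [← map_pow, hw, map_one]
    rcases hx with hx | hx <;> rcases hy with hy | hy
    · refine ⟨u * w, by rw [mul_pow, hu, hw, one_mul], Or.inl fun v => ?_⟩
      rw [Equiv.Perm.mul_apply, hx, hy, mul_assoc]
    · refine ⟨u * w, by rw [mul_pow, hu, hw, one_mul], Or.inr fun v => ?_⟩
      rw [Equiv.Perm.mul_apply, hx, hy, mul_assoc]
    · refine ⟨u * (starRingEnd ℂ) w, by rw [mul_pow, hu, hw', one_mul], Or.inr fun v => ?_⟩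
      rw [Equiv.Perm.mul_apply, hx, hy, map_mul, mul_assoc]
    · refine ⟨u * (starRingEnd ℂ) w, by rw [mul_pow, hu, hw', one_mul], Or.inl fun v => ?_⟩
      rw [Equiv.Perm.mul_apply, hx, hy, map_mul, mul_assoc, Complex.conj_conj]
  | inv x _ hx =>
    obtain ⟨u, hu, hx⟩ := hx
    rcases hx with hx | hx
    · refine ⟨u ^ 2, by rw [← pow_mul, Nat.mul_comm, pow_mul, hu, one_pow], Or.inl fun v => ?_⟩
      rw [Equiv.Perm.inv_eq_iff_eq, hx]
      linear_combination (-v) * hu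
    · refine ⟨u, hu, Or.inr fun v => ?_⟩
      rw [Equiv.Perm.inv_eq_iff_eq, hx, map_mul, Complex.conj_conj, conj_eq_sq_of_cube hu]
      linear_combination (-v) * hu

lemma mem_Gorbit_iff (v z : ℂ) :
    z ∈ Gorbit v ↔ ∃ u : ℂ, u ^ 3 = 1 ∧ (z = u * v ∨ z = u * (starRingEnd ℂ) v) := by
  constructor
  · rintro ⟨g, hg, rfl⟩
    obtain ⟨u, hu, h⟩ := exists_of_mem_dihedralG hg
    exact ⟨u, hu, h.imp (fun h => h v) fun h => h v⟩
  · rintro ⟨u, hu, h⟩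
    have hrot : rotPerm ∈ dihedralG := Subgroup.subset_closure (Or.inl rfl)
    have hconj : conjPerm ∈ dihedralG := Subgroup.subset_closure (Or.inr rfl)
    obtain ⟨i, -, hi⟩ :=
      (Complex.isPrimitiveRoot_exp 3 (by norm_num)).eq_pow_of_pow_eq_one hu
    have happ : ∀ w : ℂ, rotPerm w = Complex.exp (2 * Real.pi * Complex.I / (3 : ℕ)) * w :=
      fun w => by simp [rotPerm]
    have hpow : ∀ w : ℂ, (rotPerm ^ i) w = u * w := by
      rw [← hi]
      clear hi
      generalize Complex.exp (2 * Real.pi * Complex.I / (3 : ℕ)) = ζ at happ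
      intro w
      induction i with
      | zero => simp
      | succ i ih =>
        rw [pow_succ', Equiv.Perm.mul_apply, ih, happ, pow_succ', mul_assoc]
    rcases h with rfl | rfl
    · exact ⟨_, Subgroup.pow_mem _ hrot i, hpow v⟩
    · exact ⟨_, Subgroup.mul_mem _ (Subgroup.pow_mem _ hrot i) hconj, hpow _⟩

lemma Gorbit_eq_orbit (v : ℂ) : Gorbit v = MulAction.orbit dihedralG v := by
  ext z
  exact ⟨fun ⟨g, hg, h⟩ => ⟨⟨g, hg⟩, h⟩, fun ⟨⟨g, hg⟩, h⟩ => ⟨g, hg, h⟩⟩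

lemma Gorbit_eq_iff (v w : ℂ) : Gorbit v = Gorbit w ↔ v ∈ Gorbit w := by
  simp only [Gorbit_eq_orbit, MulAction.orbit_eq_iff]

lemma Gorbit_zero : Gorbit 0 = {0} := by
  ext z
  rw [mem_Gorbit_iff, map_zero, Set.mem_singleton_iff]
  constructor
  · rintro ⟨u, -, rfl | rfl⟩ <;> rw [mul_zero]
  · rintro rfl
    exact ⟨1, one_pow _, Or.inl (mul_zero _).symm⟩

lemma card_cubeRoots_image {v : ℂ} (hv : v ≠ 0) :
    ((Polynomial.nthRootsFinset 3 (1 : ℂ)).image fun u => u * v).card = 3 := by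
  rw [Finset.card_image_of_injective _ (mul_left_injective₀ hv), card_roots (by norm_num)]

/-- The orbit of a nonzero real number has three elements. -/
lemma ncard_Gorbit_real {v : ℂ} (hv : v ≠ 0) (hc : (starRingEnd ℂ) v = v) :
    (Gorbit v).ncard = 3 := by
  classical
  rw [← card_cubeRoots_image hv, ← Set.ncard_coe_finset]
  congr 1
  ext z
  simp only [mem_Gorbit_iff, hc, or_self, Finset.coe_image, Set.mem_image, Finset.mem_coe,
    mem_roots_iff (n := 3) (by norm_num), eq_comm (a := z)]

/-- If the orbit of a nonzero complex number has no real point, it has six elements. -/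
lemma ncard_Gorbit_of_no_real {v : ℂ} (hv : v ≠ 0)
    (hr : ∀ w ∈ Gorbit v, (starRingEnd ℂ) w ≠ w) : (Gorbit v).ncard = 6 := by
  classical
  have hv' : (starRingEnd ℂ) v ≠ 0 := (map_ne_zero _).mpr hv
  have hdisj : Disjoint ((Polynomial.nthRootsFinset 3 (1 : ℂ)).image fun u => u * v)
      ((Polynomial.nthRootsFinset 3 (1 : ℂ)).image fun u => u * (starRingEnd ℂ) v) := by
    rw [Finset.disjoint_left]
    intro z h1 h2
    simp only [Finset.mem_image, mem_roots_iff (n := 3) (by norm_num)] at h1 h2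
    obtain ⟨u, hu, rfl⟩ := h1
    obtain ⟨w, hw, h⟩ := h2
    have hs : (w ^ 2 * u) ^ 3 = 1 := by
      linear_combination (u ^ 3 * (w ^ 3 + 1)) * hw + hu
    have hs' : (starRingEnd ℂ) v = w ^ 2 * u * v := by
      linear_combination w ^ 2 * h - (starRingEnd ℂ) v * hw
    set s := w ^ 2 * u
    have hs2 : (s ^ 2) ^ 3 = 1 := by linear_combination (s ^ 3 + 1) * hs
    refine hr (s ^ 2 * v) ((mem_Gorbit_iff _ _).mpr ⟨_, hs2, Or.inl rfl⟩) ?_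
    rw [map_mul, conj_eq_sq_of_cube hs2, hs']
    linear_combination (s ^ 2 * v) * hs
  have hcard := Finset.card_union_of_disjoint hdisj
  rw [card_cubeRoots_image hv, card_cubeRoots_image hv', ← Set.ncard_coe_finset] at hcard
  refine Eq.trans ?_ hcard
  congr 1
  ext z
  simp only [mem_Gorbit_iff, Finset.coe_union, Finset.coe_image, Set.mem_union, Set.mem_image,
    Finset.mem_coe, mem_roots_iff (n := 3) (by norm_num), eq_comm (a := z)]
  constructor
  · rintro ⟨u, hu, h | h⟩
    · exact Or.inl ⟨u, hu, h⟩
    · exact Or.inr ⟨u, hu, h⟩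
  · rintro (⟨u, hu, h⟩ | ⟨u, hu, h⟩)
    · exact ⟨u, hu, Or.inl h⟩
    · exact ⟨u, hu, Or.inr h⟩

/-- Distinct nonzero real numbers have distinct orbits. -/
lemma eq_of_real_of_mem_Gorbit {v w : ℂ} (hv : v ≠ 0) (hvr : (starRingEnd ℂ) v = v)
    (hwr : (starRingEnd ℂ) w = w) (h : w ∈ Gorbit v) : w = v := by
  obtain ⟨u, hu, h⟩ := (mem_Gorbit_iff _ _).mp h
  rw [hvr, or_self] at h
  subst h
  rw [map_mul, hvr, conj_eq_sq_of_cube hu] at hwr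
  have h2 : u ^ 2 = u := mul_right_cancel₀ hv hwr
  have : u = 1 := by linear_combination hu - (u + 1) * h2
  rw [this, one_mul]

variable {n : ℕ}

lemma mem_tripleFinset_of_mem_Gorbit (hn : n ≠ 0) (h3 : 3 ∣ n) {v z : ℂ}
    (hv : v ∈ tripleFinset n) (hz : z ∈ Gorbit v) : z ∈ tripleFinset n := by
  rw [mem_tripleFinset hn, mem_TriplePts_iff hn] at *
  obtain ⟨a, b, c, ha, hb, hc, hab, hac, hbc, habc, rfl⟩ := hv
  obtain ⟨u, hu, hz⟩ := (mem_Gorbit_iff _ _).mp hz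
  have hun : u ^ n = 1 := by
    obtain ⟨k, rfl⟩ := h3
    rw [pow_mul, hu, one_pow]
  have hu0 := ne_zero_of_pow_eq_one hn hun
  have hinj : ∀ {x y : ℂ}, x ≠ y → u * x ≠ u * y := fun h h' => h (mul_left_cancel₀ hu0 h')
  rcases hz with rfl | rfl
  · refine ⟨u * a, u * b, u * c, ?_, ?_, ?_, hinj hab, hinj hac, hinj hbc, ?_, by ring⟩
    · rw [mul_pow, hun, ha, one_mul]
    · rw [mul_pow, hun, hb, one_mul]
    · rw [mul_pow, hun, hc, one_mul]
    · linear_combination u ^ 3 * habc + hu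
  · have hcinj : ∀ {x y : ℂ}, x ≠ y → u * (starRingEnd ℂ) x ≠ u * (starRingEnd ℂ) y :=
      fun h => hinj fun h' => h ((starRingEnd ℂ).injective h')
    refine ⟨u * (starRingEnd ℂ) a, u * (starRingEnd ℂ) b, u * (starRingEnd ℂ) c, ?_, ?_, ?_,
      hcinj hab, hcinj hac, hcinj hbc, ?_, ?_⟩
    · rw [mul_pow, hun, ← map_pow, ha, map_one, one_mul]
    · rw [mul_pow, hun, ← map_pow, hb, map_one, one_mul]
    · rw [mul_pow, hun, ← map_pow, hc, map_one, one_mul]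
    · have h' := congrArg (starRingEnd ℂ) habc
      rw [map_mul, map_mul, map_one] at h'
      linear_combination u ^ 3 * h' + hu
    · rw [map_add, map_add]; ring

open Classical in
/-- The set of orbits of triple points of cardinality `k`, as the image of a finite set. -/
lemma orbits_eq_image (hn : n ≠ 0) (k : ℕ) :
    {O : Set ℂ | ∃ p ∈ TriplePts n, O = Gorbit p ∧ O.ncard = k}
      = (((tripleFinset n).filter fun p => (Gorbit p).ncard = k).image Gorbit : Set (Set ℂ)) := by
  ext O
  simp only [Finset.coe_image, Finset.coe_filter, Set.mem_image, mem_tripleFinset hn]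
  constructor
  · rintro ⟨p, hp, rfl, h⟩
    exact ⟨p, ⟨hp, h⟩, rfl⟩
  · rintro ⟨p, ⟨hp, h⟩, rfl⟩
    exact ⟨p, hp, rfl, h⟩

open Classical in
/-- The points whose orbit has `k` elements are `k` times as many as their orbits. -/
lemma card_filter_eq_orbits_mul (hn : n ≠ 0) (h3 : 3 ∣ n) (k : ℕ) :
    ((tripleFinset n).filter fun p => (Gorbit p).ncard = k).card
      = ({O : Set ℂ | ∃ p ∈ TriplePts n, O = Gorbit p ∧ O.ncard = k} : Set (Set ℂ)).ncard * k := by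
  rw [orbits_eq_image hn, Set.ncard_coe_finset, ← card_eq_card_image_mul]
  intro a ha
  obtain ⟨ha, hk⟩ := Finset.mem_filter.mp ha
  rw [← Set.ncard_coe_finset]
  refine Eq.trans ?_ hk
  congr 1
  ext x
  rw [Finset.mem_coe, Finset.mem_filter, Finset.mem_filter, Gorbit_eq_iff]
  exact ⟨fun h => h.2, fun h => ⟨⟨mem_tripleFinset_of_mem_Gorbit hn h3 ha h,
    by rw [(Gorbit_eq_iff x a).mpr h, hk]⟩, h⟩⟩

lemma ncard_Gorbit_cases (v : ℂ) :
    (v = 0 ∧ (Gorbit v).ncard = 1) ∨ (v ≠ 0 ∧ (Gorbit v).ncard = 6) ∨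
      (v ≠ 0 ∧ (Gorbit v).ncard = 3 ∧
        ∃ w, w ≠ 0 ∧ (starRingEnd ℂ) w = w ∧ Gorbit w = Gorbit v) := by
  by_cases hv : v = 0
  · left
    subst hv
    rw [Gorbit_zero, Set.ncard_singleton]
    exact ⟨rfl, rfl⟩
  by_cases hr : ∀ w ∈ Gorbit v, (starRingEnd ℂ) w ≠ w
  · exact Or.inr (Or.inl ⟨hv, ncard_Gorbit_of_no_real hv hr⟩)
  · push Not at hr
    obtain ⟨w, hw, hwr⟩ := hr
    have hw' := (Gorbit_eq_iff w v).mpr hw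
    have hw0 : w ≠ 0 := by
      rintro rfl
      have := (Gorbit_eq_iff v 0).mp hw'.symm
      rw [Gorbit_zero] at this
      exact hv this
    exact Or.inr (Or.inr ⟨hv, hw' ▸ ncard_Gorbit_real hw0 hwr, w, hw0, hwr, hw'⟩)

lemma ncard_orbits_three (hn : n ≠ 0) (h2 : 2 ∣ n) (h3 : 3 ∣ n) :
    ({O : Set ℂ | ∃ p ∈ TriplePts n, O = Gorbit p ∧ O.ncard = 3} : Set (Set ℂ)).ncard
      = n / 2 - 2 := by
  classical
  set F := ((tripleFinset n).filter fun z => (starRingEnd ℂ) z = z).erase 0 with hF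
  have hmem : ∀ z, z ∈ F ↔ z ≠ 0 ∧ z ∈ tripleFinset n ∧ (starRingEnd ℂ) z = z := fun z => by
    rw [hF, Finset.mem_erase, Finset.mem_filter]
  have hcard : F.card + 1 = ((tripleFinset n).filter fun z => (starRingEnd ℂ) z = z).card := by
    refine Finset.card_erase_add_one (Finset.mem_filter.mpr ⟨zero_mem_tripleFinset hn h3, ?_⟩)
    exact map_zero _
  have himg : ({O : Set ℂ | ∃ p ∈ TriplePts n, O = Gorbit p ∧ O.ncard = 3} : Set (Set ℂ))
      = (F.image Gorbit : Set (Set ℂ)) := by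
    rw [orbits_eq_image hn]
    refine congrArg _ ?_
    ext O
    simp only [Finset.mem_image, Finset.mem_filter, hmem]
    constructor
    · rintro ⟨v, ⟨hv, h⟩, rfl⟩
      rcases ncard_Gorbit_cases v with ⟨-, h'⟩ | ⟨-, h'⟩ | ⟨-, -, w, hw0, hwr, hw⟩
      · omega
      · omega
      · exact ⟨w, ⟨hw0, mem_tripleFinset_of_mem_Gorbit hn h3 hv ((Gorbit_eq_iff _ _).mp hw), hwr⟩,
          hw⟩
    · rintro ⟨w, ⟨hw0, hw, hwr⟩, rfl⟩
      exact ⟨w, ⟨hw, ncard_Gorbit_real hw0 hwr⟩, rfl⟩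
  rw [himg, Set.ncard_coe_finset, Finset.card_image_of_injOn]
  · have := card_real_tripleFinset hn h2
    omega
  · intro v hv w hw h
    rw [Finset.mem_coe, hmem] at hv hw
    exact eq_of_real_of_mem_Gorbit hw.1 hw.2.2 hv.2.2 ((Gorbit_eq_iff _ _).mp h)

lemma orbits_one (hn : n ≠ 0) (h3 : 3 ∣ n) :
    ({O : Set ℂ | ∃ p ∈ TriplePts n, O = Gorbit p ∧ O.ncard = 1} : Set (Set ℂ)) =
      {({0} : Set ℂ)} := by
  ext O
  rw [Set.mem_singleton_iff]
  constructor
  · rintro ⟨p, -, rfl, h⟩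
    rcases ncard_Gorbit_cases p with ⟨rfl, -⟩ | ⟨-, h'⟩ | ⟨-, h', -⟩
    · exact Gorbit_zero
    · omega
    · omega
  · rintro rfl
    exact ⟨0, (mem_tripleFinset hn 0).mp (zero_mem_tripleFinset hn h3), Gorbit_zero.symm,
      Set.ncard_singleton _⟩

/-- Counting triple points by the size of their orbit. -/
lemma card_tripleFinset_eq_sum (hn : n ≠ 0) (h3 : 3 ∣ n) : (tripleFinset n).card =
    1 + ({O : Set ℂ | ∃ p ∈ TriplePts n, O = Gorbit p ∧ O.ncard = 3} : Set (Set ℂ)).ncard * 3 +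
      ({O : Set ℂ | ∃ p ∈ TriplePts n, O = Gorbit p ∧ O.ncard = 6} : Set (Set ℂ)).ncard * 6 := by
  classical
  have h1 := card_filter_eq_orbits_mul hn h3 1
  rw [orbits_one hn h3, Set.ncard_singleton, mul_one] at h1
  rw [← card_filter_eq_orbits_mul hn h3 3, ← card_filter_eq_orbits_mul hn h3 6]
  nth_rewrite 1 [← h1]
  rw [← Finset.card_union_of_disjoint, ← Finset.card_union_of_disjoint]
  · congr 1
    ext v
    simp only [Finset.mem_union, Finset.mem_filter]
    rcases ncard_Gorbit_cases v with ⟨-, h⟩ | ⟨-, h⟩ | ⟨-, h, -⟩ <;> simp [h]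
  · simp only [Finset.disjoint_left, Finset.mem_union, Finset.mem_filter]
    omega
  · simp only [Finset.disjoint_left, Finset.mem_filter]
    omega

end Orbits

/-- For `6 ∣ n`, `n ≥ 6`: the set of triple points has exactly one `G`-orbit of
cardinality 1, namely `{0}` (so the origin is a triple point), exactly
`n/2 - 2` orbits of cardinality 3, and exactly `(n-6)²/36` orbits of
cardinality 6. -/
theorem boroczky_orbit_counts_six (n : ℕ) (hn : 6 ≤ n) (hdvd : 6 ∣ n) :
    ({O : Set ℂ | ∃ p ∈ TriplePts n, O = Gorbit p ∧ O.ncard = 1} : Set (Set ℂ)) =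
      {({0} : Set ℂ)} ∧
    ({O : Set ℂ | ∃ p ∈ TriplePts n, O = Gorbit p ∧ O.ncard = 3} : Set (Set ℂ)).ncard =
      n / 2 - 2 ∧
    ({O : Set ℂ | ∃ p ∈ TriplePts n, O = Gorbit p ∧ O.ncard = 6} : Set (Set ℂ)).ncard =
      (n - 6) ^ 2 / 36 := by
  have hn0 : n ≠ 0 := by omega
  have h2 : 2 ∣ n := dvd_trans (by norm_num) hdvd
  have h3 : 3 ∣ n := dvd_trans (by norm_num) hdvd
  refine ⟨orbits_one hn0 h3, ncard_orbits_three hn0 h2 h3, ?_⟩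
  have e1 := card_tripleFinset_eq_sum hn0 h3
  have e2 := card_tripleFinset hn0 h3
  rw [ncard_orbits_three hn0 h2 h3] at e1
  generalize Set.ncard _ = X at e1 ⊢
  obtain ⟨m, rfl⟩ := hdvd
  obtain ⟨k, rfl⟩ : ∃ k, m = k + 1 := ⟨m - 1, by omega⟩
  have hd : 6 * (k + 1) / 2 - 2 = 3 * k + 1 := by omega
  rw [hd] at e1
  have hs : (6 * (k + 1) - 6) ^ 2 = 36 * k ^ 2 := by
    rw [show 6 * (k + 1) - 6 = 6 * k by omega]
    ring
  rw [hs, Nat.mul_div_cancel_left _ (by norm_num)]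
  nlinarith
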